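/- arXiv:1405.0410 — 5 statements merged into one kernel-verified Lean document; each statement's English description precedes it below -/
import Mathlib

section
/- Let P and Q be orthogonal projections on a complex Hilbert space H and let z ∈ ℂ with |z| = 1. Then the operator R = QPQ + z·QP(1−Q) + z̄·(1−Q)PQ + (1−Q)P(1−Q) is an orthogonal projection, i.e. R* = R and R² = R. -/
open ContinuousLinearMap

/-- Conjugating a star projection by an isometry gives a star projection. -/
theorem IsStarProjection.conjugate_of_star_mul_self {A : Type*} [Ring A] [StarRing A]
    {p u : A} (hp : IsStarProjection p) (hu : star u * u = 1) :
    IsStarProjection (u * p * star u) where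
  isIdempotentElem := by
    calc u * p * star u * (u * p * star u) = u * p * (star u * u) * p * star u := by
          simp only [mul_assoc]
      _ = u * (p * p) * star u := by rw [hu, mul_one, mul_assoc u p p]
      _ = u * p * star u := by rw [hp.isIdempotentElem.eq]
  isSelfAdjoint := hp.isSelfAdjoint.conjugate u

section StarAlgebra

variable {A : Type*} [Ring A] [StarRing A] [Algebra ℂ A] [StarModule ℂ A]

/-- The star of the phase rotation `q + conj z • (1 - q)`. -/
theorem IsStarProjection.star_add_conj_smul_one_sub {q : A} (hq : IsStarProjection q) (z : ℂ) :
    star (q + (starRingEnd ℂ z) • (1 - q)) = q + z • (1 - q) := by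
  simp [star_smul, hq.isSelfAdjoint.star_eq]

/-- The phase rotation `q + conj z • (1 - q)` is an isometry when `z` has modulus one. -/
theorem IsStarProjection.star_mul_self_add_conj_smul_one_sub {q : A} (hq : IsStarProjection q)
    {z : ℂ} (hz : ‖z‖ = 1) :
    star (q + (starRingEnd ℂ z) • (1 - q)) * (q + (starRingEnd ℂ z) • (1 - q)) = 1 := by
  have hzz : (starRingEnd ℂ z) * z = 1 := by simp [Complex.conj_mul', hz]
  have hqq := hq.isIdempotentElem
  rw [hq.star_add_conj_smul_one_sub, add_mul, mul_add, mul_add]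
  simp [smul_smul, hzz, hqq.eq, hqq.one_sub.eq, hqq.mul_one_sub_self, hqq.one_sub_mul_self]

/-- Twisting the off-diagonal corners of a star projection by a phase gives a star projection. -/
theorem IsStarProjection.twist {p q : A} (hp : IsStarProjection p) (hq : IsStarProjection q)
    {z : ℂ} (hz : ‖z‖ = 1) :
    IsStarProjection (q * p * q + z • (q * p * (1 - q)) +
      (starRingEnd ℂ z) • ((1 - q) * p * q) + (1 - q) * p * (1 - q)) := by
  have hzz : z * (starRingEnd ℂ z) = 1 := by simp [Complex.mul_conj', hz]
  convert hp.conjugate_of_star_mul_self (hq.star_mul_self_add_conj_smul_one_sub hz) using 1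
  rw [hq.star_add_conj_smul_one_sub, add_mul, add_mul, mul_add, mul_add]
  simp only [smul_mul_assoc, mul_smul_comm, smul_smul, hzz, one_smul]
  abel

end StarAlgebra

/-- For orthogonal projections `P`, `Q` on a complex Hilbert space and `z ∈ ℂ`
with `|z| = 1`, the operator
`R = QPQ + z·QP(1−Q) + z̄·(1−Q)PQ + (1−Q)P(1−Q)` is an orthogonal projection. -/
theorem twisted_projection_is_projection
    {H : Type*} [NormedAddCommGroup H] [InnerProductSpace ℂ H] [CompleteSpace H]
    (P Q : H →L[ℂ] H) (hP1 : P = adjoint P) (hP2 : P * P = P)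
    (hQ1 : Q = adjoint Q) (hQ2 : Q * Q = Q)
    (z : ℂ) (hz : ‖z‖ = 1) :
    adjoint (Q * P * Q + z • (Q * P * (1 - Q)) + (starRingEnd ℂ z) • ((1 - Q) * P * Q) +
        (1 - Q) * P * (1 - Q)) =
      Q * P * Q + z • (Q * P * (1 - Q)) + (starRingEnd ℂ z) • ((1 - Q) * P * Q) +
        (1 - Q) * P * (1 - Q) ∧
    (Q * P * Q + z • (Q * P * (1 - Q)) + (starRingEnd ℂ z) • ((1 - Q) * P * Q) +
        (1 - Q) * P * (1 - Q)) *
      (Q * P * Q + z • (Q * P * (1 - Q)) + (starRingEnd ℂ z) • ((1 - Q) * P * Q) +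
        (1 - Q) * P * (1 - Q)) =
      Q * P * Q + z • (Q * P * (1 - Q)) + (starRingEnd ℂ z) • ((1 - Q) * P * Q) +
        (1 - Q) * P * (1 - Q) := by
  have hP : IsStarProjection P := ⟨hP2, hP1.symm⟩
  have hQ : IsStarProjection Q := ⟨hQ2, hQ1.symm⟩
  have hR := hP.twist hQ hz
  exact ⟨hR.isSelfAdjoint, hR.isIdempotentElem⟩
end

section
/- Let H be a complex Hilbert space, 𝒜 ⊆ B(H) a C*-subalgebra, and F a unitary operator on H such that [F, A] is compact for every A ∈ 𝒜. Let M be the set of norm-continuous paths s ∈ [0,1] ↦ A_s ∈ B(H) such that A_0 ∈ 𝒜, A_s − A_0 is compact for all s ∈ [0,1], and A_1 = F*A_0F. Then M is a C*-algebra under pointwise operations and the supremum norm, the evaluation map ev(A) = A_0 is a surjective *-homomorphism from M onto 𝒜 (an explicit lift of A ∈ 𝒜 being s ↦ (1−s)A + sF*AF), and the kernel of ev is exactly the set of norm-continuous paths of compact operators vanishing at s = 0 and s = 1. In other words, the sequence 0 → SK(H) → M → 𝒜 → 0 is exact, where SK(H) = C₀((0,1), K(H)). -/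
open ContinuousLinearMap

variable {H : Type*} [NormedAddCommGroup H] [InnerProductSpace ℂ H] [CompleteSpace H]

/-- The `F`-twisted mapping cone associated to a C*-subalgebra `S ⊆ B(H)` and a unitary `F`:
norm-continuous paths `s ∈ [0,1] ↦ A_s` with `A_0 ∈ S`, `A_s − A_0` compact for all `s`,
and `A_1 = F* A_0 F`. -/
def mappingCone (S : StarSubalgebra ℂ (H →L[ℂ] H)) (F : H →L[ℂ] H) :
    Set C(unitInterval, H →L[ℂ] H) :=
  {f | f 0 ∈ S ∧ (∀ s, IsCompactOperator ⇑(f s - f 0)) ∧ f 1 = star F * f 0 * F}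

/-- An operator is compact whenever its adjoint is so: the Hilbert space case of Schauder's
theorem. -/
theorem IsCompactOperator.star_clm {T : H →L[ℂ] H} (hT : IsCompactOperator T) :
    IsCompactOperator ⇑(star T) := by
  have hTT : IsCompactOperator ⇑(T * star T) := hT.comp_clm (star T)
  have key : ∀ z : H, ‖star T z‖ ^ 2 ≤ ‖(T * star T) z‖ * ‖z‖ := fun z => by
    have h : inner ℂ (star T z) (star T z) = inner ℂ ((T * star T) z) z := by
      rw [star_eq_adjoint, adjoint_inner_right]
      rfl
    rw [← inner_self_eq_norm_sq (𝕜 := ℂ), h]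
    exact (RCLike.re_le_norm _).trans (norm_inner_le_norm _ _)
  have htb : TotallyBounded ((T * star T) '' Metric.ball 0 1) :=
    (hTT.isCompact_closure_image_ball (f := (T * star T : H →L[ℂ] H).toLinearMap)
      1).totallyBounded.subset subset_closure
  refine (isCompactOperator_iff_isCompact_closure_image_ball
    (star T : H →L[ℂ] H).toLinearMap one_pos).mpr ?_
  refine (TotallyBounded.closure (Metric.totallyBounded_iff.mpr fun ε hε => ?_)).isCompact_of_isClosed
    isClosed_closure
  obtain ⟨t, hts, htfin, htcov⟩ :=
    Metric.finite_approx_of_totallyBounded htb (ε ^ 2 / 2) (by positivity)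
  choose! g hg hgt using fun y (hy : y ∈ t) => hts hy
  refine ⟨(fun y => star T (g y)) '' t, htfin.image _, ?_⟩
  rintro _ ⟨x, hx, rfl⟩
  obtain ⟨y, hy, hxy⟩ := Set.mem_iUnion₂.mp (htcov ⟨x, hx, rfl⟩)
  refine Set.mem_iUnion₂.mpr ⟨_, ⟨y, hy, rfl⟩, ?_⟩
  have hgy := hg y hy
  rw [mem_ball_zero_iff] at hx hgy
  rw [Metric.mem_ball, ← hgt y hy, dist_eq_norm, ← map_sub] at hxy
  change dist (star T x) (star T (g y)) < ε
  rw [dist_eq_norm, ← map_sub]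
  have hn : ‖x - g y‖ ≤ 2 := (norm_sub_le _ _).trans (by linarith)
  refine lt_of_pow_lt_pow_left₀ 2 hε.le ((key _).trans_lt ?_)
  nlinarith [norm_nonneg ((T * star T) (x - g y))]

/-- For a C*-subalgebra `S ⊆ B(H)` and a unitary `F` with `[F, A]` compact for
all `A ∈ S`, the twisted mapping cone `M` is a C*-algebra (a norm-closed star-subalgebra of
`C([0,1], B(H))`), evaluation at `0` is a surjective *-homomorphism onto `S` with explicit
lift `s ↦ (1−s)A + sF*AF`, and its kernel is exactly the suspension
`SK(H) = C₀((0,1), K(H))` of the compact operators. -/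
theorem mappingCone_exact_sequence
    (S : StarSubalgebra ℂ (H →L[ℂ] H)) (hS : IsClosed (S : Set (H →L[ℂ] H)))
    (F : H →L[ℂ] H) (hF : F ∈ unitary (H →L[ℂ] H))
    (hcomm : ∀ a ∈ S, IsCompactOperator ⇑(F * a - a * F)) :
    -- `M` is a C*-algebra: a norm-closed subset stable under the *-algebra operations
    (∀ f ∈ mappingCone S F, ∀ g ∈ mappingCone S F, f + g ∈ mappingCone S F) ∧
    (∀ f ∈ mappingCone S F, ∀ g ∈ mappingCone S F, f * g ∈ mappingCone S F) ∧
    (∀ (c : ℂ), ∀ f ∈ mappingCone S F, c • f ∈ mappingCone S F) ∧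
    (∀ f ∈ mappingCone S F, star f ∈ mappingCone S F) ∧
    IsClosed (mappingCone S F) ∧
    -- evaluation at `0` is a *-homomorphism with values in `S`
    (∀ f ∈ mappingCone S F, f 0 ∈ S) ∧
    (∀ f g : C(unitInterval, H →L[ℂ] H),
      (f + g) 0 = f 0 + g 0 ∧ (f * g) 0 = f 0 * g 0 ∧ (star f) 0 = star (f 0) ∧
      ∀ c : ℂ, (c • f) 0 = c • (f 0)) ∧
    -- surjectivity, witnessed by the explicit lift `s ↦ (1−s)A + sF*AF`
    (∀ a ∈ S, ∃ f ∈ mappingCone S F, f 0 = a ∧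
      ∀ s : unitInterval, f s = (1 - (s : ℝ)) • a + (s : ℝ) • (star F * a * F)) ∧
    -- the kernel of the evaluation map is the suspension of the compact operators
    (∀ f : C(unitInterval, H →L[ℂ] H),
      (f ∈ mappingCone S F ∧ f 0 = 0) ↔
        ((∀ s, IsCompactOperator ⇑(f s)) ∧ f 0 = 0 ∧ f 1 = 0)) := by
  have hFF : F * star F = 1 := Unitary.mul_star_self_of_mem hF
  have hFF' : star F * F = 1 := Unitary.star_mul_self_of_mem hF
  refine ⟨?_, ?_, ?_, ?_, ?_, fun f hf => hf.1, fun f g => ⟨rfl, rfl, rfl, fun _ => rfl⟩,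
    ?_, ?_⟩
  · rintro f ⟨hf0, hfc, hf1⟩ g ⟨hg0, hgc, hg1⟩
    refine ⟨add_mem hf0 hg0, fun s => ?_, ?_⟩
    · rw [ContinuousMap.add_apply, ContinuousMap.add_apply, add_sub_add_comm]
      exact (hfc s).add (hgc s)
    · rw [ContinuousMap.add_apply, ContinuousMap.add_apply, hf1, hg1, mul_add, add_mul]
  · rintro f ⟨hf0, hfc, hf1⟩ g ⟨hg0, hgc, hg1⟩
    refine ⟨mul_mem hf0 hg0, fun s => ?_, ?_⟩
    · have h : (f * g) s - (f * g) 0 = f s * (g s - g 0) + (f s - f 0) * g 0 := by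
        simp only [ContinuousMap.mul_apply]
        noncomm_ring
      rw [h]
      exact ((hgc s).clm_comp (f s)).add ((hfc s).comp_clm (g 0))
    · rw [ContinuousMap.mul_apply, ContinuousMap.mul_apply, hf1, hg1]
      calc star F * f 0 * F * (star F * g 0 * F)
          = star F * f 0 * (F * star F) * g 0 * F := by simp only [mul_assoc]
        _ = star F * (f 0 * g 0) * F := by rw [hFF, mul_one]; simp only [mul_assoc]
  · rintro c f ⟨hf0, hfc, hf1⟩
    refine ⟨S.smul_mem hf0 c, fun s => ?_, ?_⟩
    · rw [ContinuousMap.smul_apply, ContinuousMap.smul_apply, ← smul_sub]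
      exact (hfc s).smul c
    · rw [ContinuousMap.smul_apply, ContinuousMap.smul_apply, hf1, mul_smul_comm,
        smul_mul_assoc]
  · rintro f ⟨hf0, hfc, hf1⟩
    refine ⟨star_mem hf0, fun s => ?_, ?_⟩
    · rw [ContinuousMap.star_apply, ContinuousMap.star_apply, ← star_sub]
      exact (hfc s).star_clm
    · rw [ContinuousMap.star_apply, ContinuousMap.star_apply, hf1]
      simp only [star_mul, star_star, mul_assoc]
  · have hev : ∀ s : unitInterval, Continuous fun f : C(unitInterval, H →L[ℂ] H) => f s :=
      fun s => continuous_eval_const s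
    have hM : mappingCone S F = (fun f => f 0) ⁻¹' (S : Set (H →L[ℂ] H)) ∩
        ((⋂ s, (fun f => f s - f 0) ⁻¹' {T : H →L[ℂ] H | IsCompactOperator ⇑T}) ∩
          {f | f 1 = star F * f 0 * F}) := by
      ext f
      simp [mappingCone]
    rw [hM]
    refine (hS.preimage (hev 0)).inter (IsClosed.inter (isClosed_iInter fun s => ?_) ?_)
    · exact isClosed_setOfPred_isCompactOperator.preimage ((hev s).sub (hev 0))
    · exact isClosed_eq (hev 1) ((continuous_const.mul (hev 0)).mul continuous_const)
  · intro a ha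
    refine ⟨⟨fun s : unitInterval => (1 - (s : ℝ)) • a + (s : ℝ) • (star F * a * F),
      by fun_prop⟩, ⟨?_, fun s => ?_, ?_⟩, ?_, fun s => rfl⟩
    · simpa using ha
    · have hc : IsCompactOperator ⇑(star F * a * F - a) := by
        have h : star F * a * F - a = -(star F * (F * a - a * F)) := by
          rw [mul_sub, ← mul_assoc, ← mul_assoc, hFF', one_mul, neg_sub]
        rw [h]
        exact ((hcomm a ha).clm_comp (star F)).neg
      have h : (1 - (s : ℝ)) • a + (s : ℝ) • (star F * a * F) -
          ((1 - ((0 : unitInterval) : ℝ)) • a + ((0 : unitInterval) : ℝ) • (star F * a * F)) =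
          (s : ℝ) • (star F * a * F - a) := by
        simp only [Set.Icc.coe_zero, sub_zero, one_smul, zero_smul, add_zero]
        module
      change IsCompactOperator ⇑((1 - (s : ℝ)) • a + (s : ℝ) • (star F * a * F) -
          ((1 - ((0 : unitInterval) : ℝ)) • a + ((0 : unitInterval) : ℝ) • (star F * a * F)))
      rw [h]
      exact hc.smul (s : ℝ)
    · simp
    · simp
  · refine fun f => ⟨fun ⟨⟨_, hfc, hf1⟩, hf0⟩ => ⟨fun s => ?_, hf0, ?_⟩,
      fun ⟨hfc, hf0, hf1⟩ => ⟨⟨?_, fun s => ?_, ?_⟩, hf0⟩⟩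
    · simpa only [hf0, sub_zero] using hfc s
    · rw [hf1, hf0, mul_zero, zero_mul]
    · rw [hf0]
      exact zero_mem S
    · rw [hf0, sub_zero]
      exact hfc s
    · rw [hf1, hf0, mul_zero, zero_mul]
end

section
/- Let H be a complex separable Hilbert space equipped with a complex conjugation C and a real unitary I (Ī = I) with I² = −1. A bounded operator T on H satisfies I*TᵗI = T (i.e. T is odd symmetric) if and only if there exists a bounded operator A on H with T = I*AᵗIA. -/
open ContinuousLinearMap

variable {H : Type*} [NormedAddCommGroup H] [InnerProductSpace ℂ H] [CompleteSpace H]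

/-- `T` is odd symmetric w.r.t. the complex conjugation `C` and the real unitary `I`:
`I* Tᵗ I = T`, where `Tᵗ = C T* C` is the transpose. Stated pointwise. -/
def OddSymmetric (C : H ≃ₗᵢ⋆[ℂ] H) (I T : H →L[ℂ] H) : Prop :=
  ∀ x, adjoint I (C (adjoint T (C (I x)))) = T x

open scoped InnerProductSpace

section InnerProductSpace

variable {E : Type*} [NormedAddCommGroup E] [InnerProductSpace ℂ E]

theorem exists_norm_eq_one_forall_inner_eq_zero (F : Submodule ℂ E) [F.HasOrthogonalProjection]
    (hF : F ≠ ⊤) : ∃ e : E, ‖e‖ = 1 ∧ ∀ x ∈ F, ⟪x, e⟫_ℂ = 0 := by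
  have h : Fᗮ ≠ ⊥ := fun h ↦ hF (Submodule.orthogonal_eq_bot_iff.mp h)
  obtain ⟨z, hz, hz0⟩ := Submodule.exists_mem_ne_zero_of_ne_bot h
  refine ⟨((‖z‖⁻¹ : ℝ) : ℂ) • z, ?_, fun x hx ↦ ?_⟩
  · rw [norm_smul]
    simp [hz0]
  · rw [inner_smul_right, (Submodule.mem_orthogonal F z).mp hz x hx, mul_zero]

theorem countable_of_orthonormal [TopologicalSpace.SeparableSpace E] {ι : Type*} {b : ι → E}
    (hb : Orthonormal ℂ b) : Countable ι := by
  refine Pairwise.countable_of_isOpen_disjoint (s := fun i ↦ Metric.ball (b i) (1 / 2))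
    (fun i j hij ↦ Metric.ball_disjoint_ball ?_) (fun i ↦ Metric.isOpen_ball)
    (fun i ↦ ⟨b i, Metric.mem_ball_self (by norm_num)⟩)
  have h := norm_sub_sq (𝕜 := ℂ) (b i) (b j)
  rw [hb.2 hij, hb.1 i, hb.1 j] at h
  rw [dist_eq_norm]
  norm_num at h
  nlinarith [norm_nonneg (b i - b j)]

theorem ConjLinearIsometry.inner_map_map (J : E →ₗᵢ⋆[ℂ] E) (x y : E) :
    ⟪J x, J y⟫_ℂ = ⟪y, x⟫_ℂ := by
  have h₁ : J x - Complex.I • J y = J (x + Complex.I • y) := by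
    simp [map_smulₛₗ, sub_eq_add_neg]
  have h₂ : J x + Complex.I • J y = J (x - Complex.I • y) := by
    simp [map_smulₛₗ]
  rw [← inner_conj_symm y x, inner_eq_sum_norm_sq_div_four (J x) (J y),
    inner_eq_sum_norm_sq_div_four x y]
  simp only [Complex.coe_algebraMap, RCLike.I_to_complex, h₁, h₂, ← map_add, ← map_sub,
    J.norm_map]
  simp only [map_div₀, map_add, map_sub, map_mul, map_pow, Complex.conj_ofReal, Complex.conj_I,
    map_ofNat]
  ring

theorem inner_map_left_eq_neg {J : E →ₗᵢ⋆[ℂ] E} (hJ : ∀ x, J (J x) = -x) (x y : E) :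
    ⟪J x, y⟫_ℂ = -⟪J y, x⟫_ℂ := by
  rw [← ConjLinearIsometry.inner_map_map J y, hJ, inner_neg_right]

theorem inner_map_left_self_eq_zero {J : E →ₗᵢ⋆[ℂ] E} (hJ : ∀ x, J (J x) = -x) (x : E) :
    ⟪J x, x⟫_ℂ = 0 :=
  self_eq_neg.mp (inner_map_left_eq_neg hJ x x)

/-- Every alternating form on a finite-dimensional space is the pullback of the symplectic form
`(x, y) ↦ ⟪J x, y⟫`. The subspace `F` controls the rank of the pullback for the induction. -/
theorem exists_pullback_of_isAlt [FiniteDimensional ℂ E] {J : E →ₗᵢ⋆[ℂ] E}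
    (hJ : ∀ x, J (J x) = -x) (n : ℕ)
    (B : E →ₗ[ℂ] E →ₗ[ℂ] ℂ) (hB : B.IsAlt)
    (hn : Module.finrank ℂ E ≤ n + Module.finrank ℂ (LinearMap.ker B)) :
    ∃ (A : E →ₗ[ℂ] E) (F : Submodule ℂ E), (∀ x, A x ∈ F) ∧ (∀ x ∈ F, J x ∈ F) ∧
      Module.finrank ℂ F + Module.finrank ℂ (LinearMap.ker B) ≤ Module.finrank ℂ E ∧
      ∀ x y, B x y = ⟪J (A x), A y⟫_ℂ := by
  induction n using Nat.strong_induction_on generalizing B with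
  | _ n ih =>
  by_cases h0 : B = 0
  · refine ⟨0, ⊥, by simp, by simp, ?_, by simp [h0]⟩
    simpa using Submodule.finrank_le (LinearMap.ker B)
  obtain ⟨e, f, hef⟩ : ∃ e f, B e f = 1 := by
    have : ∃ e f, B e f ≠ 0 := by
      by_contra! h
      exact h0 (LinearMap.ext₂ h)
    obtain ⟨e, f, h⟩ := this
    exact ⟨e, (B e f)⁻¹ • f, by simp [h]⟩
  have hskew : ∀ x y, B x y = -B y x := fun x y ↦ by rw [hB.neg]
  have hfe : B f e = -1 := by rw [hskew, hef]
  let B' : E →ₗ[ℂ] E →ₗ[ℂ] ℂ := B - (B e).smulRight (B f) + (B f).smulRight (B e)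
  have hB'apply : ∀ x y, B' x y = B x y - B e x * B f y + B f x * B e y := fun x y ↦ by
    simp [B']
  have hB' : B'.IsAlt := fun x ↦ by rw [hB'apply, hB.self_eq_zero]; ring
  have hkerB : LinearMap.ker B ≤ LinearMap.ker B' := fun x hx ↦ by
    rw [LinearMap.mem_ker] at hx ⊢
    ext y
    rw [hB'apply, hskew e x, hskew f x, hx]
    simp
  have heB' : e ∈ LinearMap.ker B' := by
    rw [LinearMap.mem_ker]
    ext y
    rw [hB'apply, hB.self_eq_zero, hfe]
    simp
  have hfB' : f ∈ LinearMap.ker B' := by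
    rw [LinearMap.mem_ker]
    ext y
    rw [hB'apply, hB.self_eq_zero, hef]
    simp
  have hlt₁ : LinearMap.ker B < LinearMap.ker B ⊔ Submodule.span ℂ {e} := by
    refine lt_of_le_of_ne le_sup_left fun h ↦ ?_
    have he : e ∈ LinearMap.ker B := by
      rw [h]
      exact Submodule.mem_sup_right (Submodule.mem_span_singleton_self e)
    rw [LinearMap.mem_ker] at he
    simp [he] at hef
  have hlt₂ : LinearMap.ker B ⊔ Submodule.span ℂ {e} < LinearMap.ker B' := by
    refine lt_of_le_of_ne (sup_le hkerB ?_) fun h ↦ ?_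
    · rwa [Submodule.span_singleton_le_iff_mem]
    · rw [← h] at hfB'
      obtain ⟨k, hk, z, hz, rfl⟩ := Submodule.mem_sup.mp hfB'
      obtain ⟨c, rfl⟩ := Submodule.mem_span_singleton.mp hz
      rw [LinearMap.mem_ker] at hk
      rw [map_add, hskew e k, hk, map_smul, hB.self_eq_zero] at hef
      simp at hef
  have hrank₁ := Submodule.finrank_lt_finrank_of_lt hlt₁
  have hrank₂ := Submodule.finrank_lt_finrank_of_lt hlt₂
  have hle := Submodule.finrank_le (LinearMap.ker B')
  obtain ⟨A, F, hAF, hJF, hF, hA⟩ := ih (n - 1) (by lia) B' hB' (by lia)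
  obtain ⟨u, hu, huF⟩ := exists_norm_eq_one_forall_inner_eq_zero F fun h ↦ by
    rw [h, finrank_top] at hF
    lia
  have huF' : ∀ x ∈ F, ⟪x, J u⟫_ℂ = 0 := fun x hx ↦ by
    rw [← inner_conj_symm, inner_map_left_eq_neg hJ, huF _ (hJF x hx)]
    simp
  have hFu : ∀ x ∈ F, ⟪u, x⟫_ℂ = 0 := fun x hx ↦ by rw [← inner_conj_symm, huF x hx, map_zero]
  have hFu' : ∀ x ∈ F, ⟪J u, x⟫_ℂ = 0 := fun x hx ↦ by
    rw [← inner_conj_symm, huF' x hx, map_zero]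
  have huu : ⟪u, u⟫_ℂ = 1 := by simp [inner_self_eq_norm_sq_to_K, hu]
  have hJuJu : ⟪J u, J u⟫_ℂ = 1 := by rw [ConjLinearIsometry.inner_map_map, huu]
  have hJuu := inner_map_left_self_eq_zero hJ u
  have huJu : ⟪u, J u⟫_ℂ = 0 := by rw [← inner_conj_symm, hJuu, map_zero]
  refine ⟨A + (B e).smulRight u + (B f).smulRight (J u), F ⊔ Submodule.span ℂ {u, J u},
    fun x ↦ ?_, fun x hx ↦ ?_, ?_, fun x y ↦ ?_⟩
  · have hu_mem : u ∈ Submodule.span ℂ {u, J u} := Submodule.subset_span (by simp)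
    have hJu_mem : J u ∈ Submodule.span ℂ {u, J u} := Submodule.subset_span (by simp)
    rw [LinearMap.add_apply, LinearMap.add_apply, add_assoc]
    exact Submodule.add_mem_sup (hAF x)
      (add_mem (Submodule.smul_mem _ _ hu_mem) (Submodule.smul_mem _ _ hJu_mem))
  · obtain ⟨k, hk, z, hz, rfl⟩ := Submodule.mem_sup.mp hx
    obtain ⟨a, b, rfl⟩ := Submodule.mem_span_pair.mp hz
    rw [map_add]
    refine Submodule.add_mem_sup (hJF k hk) (Submodule.mem_span_pair.mpr
      ⟨-starRingEnd ℂ b, starRingEnd ℂ a, ?_⟩)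
    simp [map_smulₛₗ, hJ, add_comm]
  · have h₁ := Submodule.finrank_add_le_finrank_add_finrank F (Submodule.span ℂ {u, J u})
    have h₂ : Module.finrank ℂ (Submodule.span ℂ {u, J u}) ≤ 2 := by
      classical
      have := finrank_span_finset_le_card (R := ℂ) ({u, J u} : Finset E)
      simp only [Finset.coe_insert, Finset.coe_singleton] at this
      exact this.trans Finset.card_le_two
    lia
  · have hBB : B x y = B' x y + B e x * B f y - B f x * B e y := by rw [hB'apply]; ring
    rw [hBB, hA]
    simp only [LinearMap.add_apply, LinearMap.smulRight_apply, map_add, map_smulₛₗ, hJ,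
      inner_add_left, inner_add_right, inner_smul_left, inner_smul_right, inner_neg_left,
      smul_neg, Complex.conj_conj, huu, hJuJu, hJuu, huJu, hFu _ (hAF y), hFu' _ (hAF y),
      huF _ (hJF _ (hAF x)), huF' _ (hJF _ (hAF x))]
    ring

end InnerProductSpace

section QuaternionicStructure

variable {J : H →ₗᵢ⋆[ℂ] H}

/-- An infinite-dimensional separable space with a quaternionic structure `J` embeds isometrically
onto a subspace that is isotropic for the symplectic form `(x, y) ↦ ⟪J x, y⟫`. -/
theorem exists_linearIsometry_isotropic [TopologicalSpace.SeparableSpace H]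
    (hH : ¬FiniteDimensional ℂ H) (hJ : ∀ x, J (J x) = -x) :
    ∃ U : H →ₗᵢ[ℂ] H, ∀ x y, ⟪J (U x), U y⟫_ℂ = 0 := by
  obtain ⟨e, he, hee⟩ := exists_seq_of_forall_finset_exists (fun x : H ↦ ‖x‖ = 1)
    (fun x y ↦ ⟪x, y⟫_ℂ = 0 ∧ ⟪J x, y⟫_ℂ = 0) fun s _ ↦ by
      let t : Set H := s ∪ J '' s
      have ht : t.Finite := s.finite_toSet.union (s.finite_toSet.image J)
      have := FiniteDimensional.span_of_finite ℂ ht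
      obtain ⟨u, hu, hut⟩ := exists_norm_eq_one_forall_inner_eq_zero (Submodule.span ℂ t)
        fun h ↦ hH (Module.finite_def.mpr (h ▸ Submodule.fg_span ht))
      exact ⟨u, hu, fun x hx ↦ ⟨hut x (Submodule.subset_span (Or.inl hx)),
        hut _ (Submodule.subset_span (Or.inr ⟨x, hx, rfl⟩))⟩⟩
  have he_orth : Orthonormal ℂ e := by
    refine ⟨he, fun i j hij ↦ ?_⟩
    rcases lt_or_gt_of_ne hij with h | h
    · exact (hee i j h).1
    · rw [← inner_conj_symm, (hee j i h).1, map_zero]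
  have he_isotropic : ∀ i j, ⟪J (e i), e j⟫_ℂ = 0 := fun i j ↦ by
    rcases lt_trichotomy i j with h | rfl | h
    · exact (hee i j h).2
    · exact inner_map_left_self_eq_zero hJ _
    · rw [inner_map_left_eq_neg hJ, (hee j i h).2, neg_zero]
  obtain ⟨w, b, -⟩ := exists_hilbertBasis ℂ H
  have : Countable w := countable_of_orthonormal b.orthonormal
  obtain ⟨g, hg⟩ := exists_injective_nat w
  have hge := (he_orth.comp g hg).orthogonalFamily
  let V := hge.linearIsometry
  have hV_right : ∀ z, (∀ i, ⟪z, e i⟫_ℂ = 0) → ∀ v, ⟪z, V v⟫_ℂ = 0 := fun z hz v ↦ by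
    have h := (hge.hasSum_linearIsometry v).mapL (innerSL ℂ z)
    refine h.unique ?_
    convert hasSum_zero with i
    simp [hz]
  refine ⟨V.comp b.repr.toLinearIsometry, fun x y ↦ hV_right _ (fun i ↦ ?_) _⟩
  rw [inner_map_left_eq_neg hJ, neg_eq_zero]
  exact hV_right _ (fun j ↦ he_isotropic i j) _

theorem exists_pullback_of_infiniteDimensional [TopologicalSpace.SeparableSpace H]
    (hH : ¬FiniteDimensional ℂ H) (hJ : ∀ x, J (J x) = -x)
    (T : H →L[ℂ] H) (hT : ∀ x y, ⟪J (T x), y⟫_ℂ = -⟪J (T y), x⟫_ℂ) :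
    ∃ A : H →L[ℂ] H, ∀ x y, ⟪J (T x), y⟫_ℂ = ⟪J (A x), A y⟫_ℂ := by
  obtain ⟨U, hU⟩ := exists_linearIsometry_isotropic hH hJ
  let K : H →L⋆[ℂ] H := J.toContinuousLinearMap.comp T
  let W : H →L⋆[ℂ] H := J.toContinuousLinearMap.comp U.toContinuousLinearMap
  let A : H →L[ℂ] H := U.toContinuousLinearMap - (1 / 2 : ℂ) • W.comp K
  refine ⟨A, fun x y ↦ ?_⟩
  have hA : ∀ z, A z = U z - (1 / 2 : ℂ) • J (U (J (T z))) := fun z ↦ rfl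
  have hJU : ∀ x y, ⟪U x, J (U y)⟫_ℂ = 0 := fun x y ↦ by
    rw [← inner_conj_symm, hU, map_zero]
  simp only [hA, map_sub, map_smulₛₗ, hJ, inner_sub_left, inner_sub_right, inner_smul_left,
    inner_smul_right, inner_neg_left, smul_neg, ConjLinearIsometry.inner_map_map,
    U.inner_map_map, hU, hJU]
  rw [hT y x]
  simp
  ring

theorem exists_pullback_of_skew [TopologicalSpace.SeparableSpace H]
    (hJ : ∀ x, J (J x) = -x) (T : H →L[ℂ] H)
    (hT : ∀ x y, ⟪J (T x), y⟫_ℂ = -⟪J (T y), x⟫_ℂ) :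
    ∃ A : H →L[ℂ] H, ∀ x y, ⟪J (T x), y⟫_ℂ = ⟪J (A x), A y⟫_ℂ := by
  by_cases hH : FiniteDimensional ℂ H
  · let B : H →ₗ[ℂ] H →ₗ[ℂ] ℂ := LinearMap.mk₂ ℂ (fun x y ↦ ⟪J (T x), y⟫_ℂ)
      (fun x y z ↦ by simp) (fun c x y ↦ by simp [map_smulₛₗ, mul_comm])
      (fun x y z ↦ by simp) (fun c x y ↦ by simp)
    obtain ⟨A, -, -, -, -, hA⟩ := exists_pullback_of_isAlt hJ (Module.finrank ℂ H) B
      (fun x ↦ self_eq_neg.mp (hT x x)) le_self_add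
    exact ⟨LinearMap.toContinuousLinearMap A, hA⟩
  · exact exists_pullback_of_infiniteDimensional hH hJ T hT

end QuaternionicStructure

/-- (Representation theorem for odd symmetric operators) On a complex separable
Hilbert space with complex conjugation `C` and real unitary `I` with `I² = −1`, a bounded
operator `T` is odd symmetric (`I*TᵗI = T`) if and only if `T = I*AᵗIA` for some bounded
operator `A`. -/
theorem oddSymmetric_iff_exists_representation
    [TopologicalSpace.SeparableSpace H]
    (C : H ≃ₗᵢ⋆[ℂ] H) (hC : ∀ x, C (C x) = x)
    (I : H →L[ℂ] H) (hI : I ∈ unitary (H →L[ℂ] H))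
    (hIreal : ∀ x, C (I (C x)) = I x) (hI2 : I * I = -1)
    (T : H →L[ℂ] H) :
    OddSymmetric C I T ↔
      ∃ A : H →L[ℂ] H, ∀ x, T x = adjoint I (C (adjoint A (C (I (A x))))) := by
  have hII : ∀ x, I (I x) = -x := fun x ↦ by
    simpa using congrArg (fun S : H →L[ℂ] H ↦ S x) hI2
  have hadjI : ∀ x, adjoint I (I x) = x := fun x ↦
    congrArg (fun S : H →L[ℂ] H ↦ S x) (Unitary.mem_iff.mp hI).1
  have hIadj : ∀ x, I (adjoint I x) = x := fun x ↦
    congrArg (fun S : H →L[ℂ] H ↦ S x) (Unitary.mem_iff.mp hI).2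
  have hInorm : ∀ x, ‖I x‖ = ‖x‖ := (norm_map_iff_adjoint_comp_self I).mpr
    (ContinuousLinearMap.ext hadjI)
  let I' : H →ₗᵢ[ℂ] H := ⟨I, hInorm⟩
  let J : H →ₗᵢ⋆[ℂ] H := C.toLinearIsometry.comp I'
  have hJapply : ∀ x, J x = C (I x) := fun x ↦ rfl
  have hJ : ∀ x, J (J x) = -x := fun x ↦ by
    rw [hJapply, hJapply, hIreal, hII]
  have hsolve : ∀ z x, adjoint I (C z) = x ↔ z = J x := fun z x ↦ by
    constructor
    · rintro rfl
      rw [hJapply, hIadj, hC]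
    · rintro rfl
      rw [hJapply, hC, hadjI]
  have hodd : OddSymmetric C I T ↔ ∀ x y, ⟪J (T x), y⟫_ℂ = -⟪J (T y), x⟫_ℂ := by
    refine forall_congr' fun x ↦ ?_
    rw [hsolve, ext_iff_inner_right ℂ]
    refine forall_congr' fun y ↦ ?_
    rw [adjoint_inner_left, ← hJapply, inner_map_left_eq_neg hJ x, eq_comm]
  have hrep : ∀ A : H →L[ℂ] H, (∀ x, T x = adjoint I (C (adjoint A (C (I (A x)))))) ↔
      ∀ x y, ⟪J (T x), y⟫_ℂ = ⟪J (A x), A y⟫_ℂ := fun A ↦ by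
    refine forall_congr' fun x ↦ ?_
    rw [eq_comm, hsolve, eq_comm, ext_iff_inner_right ℂ]
    refine forall_congr' fun y ↦ ?_
    rw [adjoint_inner_left, hJapply (A x)]
  simp only [hrep]
  rw [hodd]
  refine ⟨exists_pullback_of_skew hJ T, fun ⟨A, hA⟩ x y ↦ ?_⟩
  rw [hA, hA, inner_map_left_eq_neg hJ]
end

section
/- Let H be a complex separable Hilbert space equipped with a complex conjugation C and a real unitary I (Ī = I) with I² = −1. Then the set of odd symmetric invertible bounded operators on H and the set of odd symmetric unitary operators on H are each path-connected in the operator norm topology. -/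
open ContinuousLinearMap

variable {H : Type*} [NormedAddCommGroup H] [InnerProductSpace ℂ H] [CompleteSpace H]

section CStarAlgebra

variable {A : Type*} [CStarAlgebra A]

theorem mul_inverse_mem_unitary {n d : A} (hd : IsUnit d) (hc : Commute n d)
    (h1 : star n * n = star d * d) (h2 : n * star n = d * star d) :
    n * Ring.inverse d ∈ unitary A := by
  obtain ⟨u, rfl⟩ := hd
  have hc' : n * ↑u⁻¹ = ↑u⁻¹ * n := hc.units_inv_right
  have hs : star (↑u⁻¹ : A) * star (u : A) = 1 := by rw [← star_mul]; simp
  have hs' : star (u : A) * star (↑u⁻¹ : A) = 1 := by rw [← star_mul]; simp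
  rw [Ring.inverse_unit]
  refine Unitary.mem_iff.2 ⟨?_, ?_⟩
  · calc star (n * ↑u⁻¹) * (n * ↑u⁻¹) = star (↑u⁻¹ : A) * (star n * n) * ↑u⁻¹ := by
          simp only [star_mul, mul_assoc]
      _ = (star (↑u⁻¹ : A) * star (u : A)) * (u * ↑u⁻¹) := by rw [h1]; simp only [mul_assoc]
      _ = 1 := by rw [hs]; simp
  · calc n * ↑u⁻¹ * star (n * ↑u⁻¹) = ↑u⁻¹ * (n * star n) * star (↑u⁻¹ : A) := by
          rw [hc']; simp only [star_mul, mul_assoc]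
      _ = (↑u⁻¹ * u) * (star (u : A) * star (↑u⁻¹ : A)) := by rw [h2]; simp only [mul_assoc]
      _ = 1 := by rw [hs']; simp

variable [PartialOrder A] [StarOrderedRing A]

/-- If a unitary has nonnegative real part, then `1 + a w` is invertible for all `a ≥ 0`. -/
theorem isUnit_one_add_smul_of_mem_unitary {w : A} (hw : w ∈ unitary A) (hw0 : 0 ≤ w + star w)
    {a : ℝ} (ha : 0 ≤ a) : IsUnit (1 + a • w) := by
  have h1 := Unitary.star_mul_self_of_mem hw
  have h2 := Unitary.mul_star_self_of_mem hw
  have e1 : star (1 + a • w) * (1 + a • w) = 1 + ((a * a) • 1 + a • (w + star w)) := by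
    simp [mul_add, add_mul, h1, smul_smul]; abel
  have e2 : (1 + a • w) * star (1 + a • w) = 1 + ((a * a) • 1 + a • (w + star w)) := by
    simp [mul_add, add_mul, h2, smul_smul]; abel
  have hc : Commute (star (1 + a • w)) (1 + a • w) := e1.trans e2.symm
  have hle : (1 : A) ≤ star (1 + a • w) * (1 + a • w) := by
    rw [e1]
    exact le_add_of_nonneg_right
      (add_nonneg (smul_nonneg (mul_self_nonneg a) zero_le_one) (smul_nonneg ha hw0))
  exact (hc.isUnit_mul_iff.1 (CStarAlgebra.isUnit_of_le 1 hle)).2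

end CStarAlgebra

section Intertwines

variable {E : Type*} [NormedAddCommGroup E] [InnerProductSpace ℂ E]

/-- `B K = K A`. -/
def Intertwines (K : E →L⋆[ℂ] E) (A B : E →L[ℂ] E) : Prop := ∀ x, B (K x) = K (A x)

namespace Intertwines

variable {K : E →L⋆[ℂ] E} {A B A₂ B₂ : E →L[ℂ] E}

theorem one : Intertwines K 1 1 := fun _ ↦ rfl

theorem add (h : Intertwines K A B) (h' : Intertwines K A₂ B₂) :
    Intertwines K (A + A₂) (B + B₂) := fun x ↦ by simp [h x, h' x]

theorem mul (h : Intertwines K A B) (h' : Intertwines K A₂ B₂) :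
    Intertwines K (A * A₂) (B * B₂) := fun x ↦ by simp [h (A₂ x), h' x]

theorem smul (h : Intertwines K A B) (c : ℂ) : Intertwines K (c • A) (star c • B) :=
  fun x ↦ by simp [h x]

theorem real_smul (h : Intertwines K A B) (c : ℝ) : Intertwines K (c • A) (c • B) := by
  simpa using h.smul (c : ℂ)

theorem inverse (h : Intertwines K A B) (hA : IsUnit A) (hB : IsUnit B) :
    Intertwines K (Ring.inverse A) (Ring.inverse B) := fun x ↦ by
  have e1 : A (Ring.inverse A x) = x := congr($(Ring.mul_inverse_cancel A hA) x)
  have e2 (y) : Ring.inverse B (B y) = y := congr($(Ring.inverse_mul_cancel B hB) y)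
  rw [← e2 (K (Ring.inverse A x)), h, e1]

end Intertwines

end Intertwines

namespace Intertwines

variable {K : H →L⋆[ℂ] H} {A B : H →L[ℂ] H}

theorem star (hK : ∀ x y, inner ℂ (K x) (K y) = inner ℂ y x) (hK2 : ∀ x, K (K x) = -x)
    (h : Intertwines K A B) : Intertwines K (star A) (star B) := fun x ↦ by
  refine ext_inner_right ℂ fun y ↦ ?_
  obtain ⟨z, rfl⟩ : ∃ z, K z = y := ⟨-K y, by simp [hK2]⟩
  rw [star_eq_adjoint, star_eq_adjoint, adjoint_inner_left, h, hK, hK, adjoint_inner_right]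

/-- Conjugation by `K` preserves square roots. -/
theorem of_mul_self (hK : ∀ x y, inner ℂ (K x) (K y) = inner ℂ y x) (hK2 : ∀ x, K (K x) = -x)
    (hA : 0 ≤ A) (hB : 0 ≤ B) (h : Intertwines K (A * A) (B * B)) : Intertwines K A B := by
  let S : H →L[ℂ] H := -(K.comp (A.comp K))
  have hSK : Intertwines K A S := fun x ↦ by simp [S, hK2]
  have hS : 0 ≤ S := by
    have hA' := ((nonneg_iff_isPositive A).1 hA).inner_left_eq_inner_right
    rw [nonneg_iff_isPositive] at hA ⊢
    rw [isPositive_iff_complex] at hA ⊢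
    intro x
    obtain ⟨z, rfl⟩ : ∃ z, K z = x := ⟨-K x, by simp [hK2]⟩
    rw [hSK, hK, ← hA']
    exact hA z
  have hSS : S * S = B * B := by
    ext x
    obtain ⟨z, rfl⟩ : ∃ z, K z = x := ⟨-K x, by simp [hK2]⟩
    rw [hSK.mul hSK, h]
  rwa [← (CFC.sqrt_unique hSS hS).symm.trans (CFC.sqrt_unique rfl hB)]

/-- The kernel of an operator intertwined with itself has an intertwined projection. -/
theorem starProjection_ker (hK : ∀ x y, inner ℂ (K x) (K y) = inner ℂ y x)
    (hK2 : ∀ x, K (K x) = -x) (h : Intertwines K A A) :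
    Intertwines K A.ker.starProjection A.ker.starProjection := fun x ↦ by
  have hker {y} (hy : y ∈ A.ker) : K y ∈ A.ker := by
    have hy' : A y = 0 := hy
    change A (K y) = 0
    rw [h, hy', map_zero]
  refine Submodule.eq_starProjection_of_mem_orthogonal
    (hker (A.ker.starProjection_apply_mem x)) ?_
  rw [Submodule.mem_orthogonal, ← map_sub]
  intro n hn
  have := hK (K (-n)) (x - A.ker.starProjection x)
  rw [hK2, neg_neg] at this
  rw [this]
  exact (Submodule.mem_orthogonal' _ _).1 (A.ker.sub_starProjection_mem_orthogonal x) _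
    (hker (neg_mem hn))

end Intertwines

theorem Commute.starProjection_ker {A T : H →L[ℂ] H} (h : Commute T A) (h' : Commute (star T) A) :
    Commute T A.ker.starProjection := by
  have hker {B : H →L[ℂ] H} (hB : Commute B A) {y} (hy : y ∈ A.ker) : B y ∈ A.ker := by
    have hy' : A y = 0 := hy
    have : A (B y) = B (A y) := congr($(hB.symm.eq) y)
    change A (B y) = 0
    rw [this, hy', map_zero]
  refine ContinuousLinearMap.ext fun x ↦ Eq.symm ?_
  refine Submodule.eq_starProjection_of_mem_orthogonal
    (hker h (A.ker.starProjection_apply_mem x)) ?_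
  have e : T x - (T * A.ker.starProjection) x = T (x - A.ker.starProjection x) :=
    (map_sub T _ _).symm
  refine (Submodule.mem_orthogonal _ _).2 fun n hn ↦ ?_
  change inner ℂ n (T x - (T * A.ker.starProjection) x) = 0
  rw [e, ← adjoint_inner_left]
  exact (Submodule.mem_orthogonal _ _).1 (A.ker.sub_starProjection_mem_orthogonal x) _
    (hker h' hn)

/-- A self-adjoint operator `S` has a sign: a symmetry `G` with `S G = |S|` that commutes with
everything that commutes with `S`, and is intertwined with itself whenever `S` is. -/
theorem exists_sign {K : H →L⋆[ℂ] H} (hK : ∀ x y, inner ℂ (K x) (K y) = inner ℂ y x)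
    (hK2 : ∀ x, K (K x) = -x) {S : H →L[ℂ] H} (hS : IsSelfAdjoint S) (h : Intertwines K S S) :
    ∃ G : H →L[ℂ] H, IsSelfAdjoint G ∧ G * G = 1 ∧ Intertwines K G G ∧ 0 ≤ S * G ∧
      ∀ T, Commute S T → Commute S (star T) → Commute T G := by
  have habs := CFC.abs_nonneg S
  have habs2 : CFC.abs S * CFC.abs S = S * S := by rw [CFC.abs_mul_abs, hS.star_eq]
  have hKabs : Intertwines K (CFC.abs S) (CFC.abs S) :=
    .of_mul_self hK hK2 habs habs (by rw [habs2]; exact h.mul h)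
  have hcomm {T} (h₁ : Commute S T) (h₂ : Commute S (star T)) :
      Commute T (CFC.abs S + (-1 : ℂ) • S) :=
    (h₁.cfcAbs_left h₂).symm.add_right (h₁.symm.smul_right _)
  set N : H →L[ℂ] H := CFC.abs S + (-1 : ℂ) • S with hN
  have hKN : Intertwines K N N := by simpa [hN] using hKabs.add (h.smul (-1))
  set P := N.ker.starProjection with hP
  have hKP : Intertwines K P P := hKN.starProjection_ker hK hK2
  have hPsa : IsSelfAdjoint P := isSelfAdjoint_starProjection _
  have hPP : P * P = P := Submodule.isIdempotentElem_starProjection _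
  have hSabs : CFC.abs S * S = S * CFC.abs S := (CFC.commute_abs_self S hS.isStarNormal).eq
  have e1 : S * P = CFC.abs S * P := by
    ext x
    have : N (P x) = 0 := N.ker.starProjection_apply_mem x
    have h2 : CFC.abs S (P x) + (-1 : ℂ) • S (P x) = 0 := this
    change S (P x) = CFC.abs S (P x)
    rw [neg_one_smul, ← sub_eq_add_neg, sub_eq_zero] at h2
    exact h2.symm
  have e2 : P * (CFC.abs S + S) = CFC.abs S + S := by
    ext x
    refine Submodule.starProjection_eq_self_iff.2 ?_
    have : N * (CFC.abs S + S) = 0 := by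
      rw [hN]
      simp only [neg_one_smul, add_mul, mul_add, neg_mul, habs2, hSabs]
      abel
    exact congr($this x)
  have e3 : (CFC.abs S + S) * P = CFC.abs S + S := by
    have := congr(star $e2)
    simpa [hPsa.star_eq, hS.star_eq, (IsSelfAdjoint.of_nonneg habs).star_eq] using this
  have e4 : S * ((2 : ℂ) • P + (-1 : ℂ) • 1) = CFC.abs S := by
    have : S * P + S * P = CFC.abs S + S := by
      nth_rw 1 [e1]
      rw [← add_mul, e3]
    rw [two_smul, mul_add, mul_add, this]
    simp
  refine ⟨(2 : ℂ) • P + (-1 : ℂ) • 1, ?_, ?_, ?_, e4 ▸ habs, ?_⟩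
  · simp [IsSelfAdjoint, hPsa.star_eq]
  · simp only [neg_one_smul, two_smul, add_mul, mul_add, hPP]
    simp
    abel
  · simpa using (hKP.smul 2).add (Intertwines.one.smul (-1))
  · intro T h₁ h₂
    have : Commute T P := Commute.starProjection_ker (hcomm h₁ h₂)
      (hcomm h₂ (by rwa [star_star]))
    exact (this.smul_right _).add_right ((Commute.one_right T).smul_right _)

/-- The unitaries `T` with `T* K = K T`. -/
def oddUnitary (K : H →L⋆[ℂ] H) : Set (H →L[ℂ] H) :=
  {T | T ∈ unitary (H →L[ℂ] H) ∧ Intertwines K T (star T)}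

/-- A Möbius path joins an odd unitary with nonnegative real part to the identity. -/
theorem joinedIn_oddUnitary_one {K : H →L⋆[ℂ] H} {W : H →L[ℂ] H} (hW : W ∈ oddUnitary K)
    (hW0 : 0 ≤ W + star W) : JoinedIn (oddUnitary K) W 1 := by
  have hd {a : ℝ} (ha : a ∈ unitInterval) := isUnit_one_add_smul_of_mem_unitary hW.1 hW0 ha.1
  have h1 := Unitary.star_mul_self_of_mem hW.1
  have h2 := Unitary.mul_star_self_of_mem hW.1
  refine JoinedIn.ofLine (f := fun a : ℝ ↦ (a • 1 + W) * Ring.inverse (1 + a • W)) ?_ ?_ ?_ ?_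
  · intro a ha
    refine ContinuousAt.continuousWithinAt (ContinuousAt.mul (by fun_prop) ?_)
    obtain ⟨u, hu⟩ := hd ha
    exact ContinuousAt.comp (g := Ring.inverse) (hu ▸ NormedRing.inverse_continuousAt u)
      (by fun_prop)
  · simp
  · have := hd (a := 1) (by simp)
    simp only [one_smul] at this ⊢
    rw [Ring.mul_inverse_cancel _ this]
  · rintro _ ⟨a, ha, rfl⟩
    have hcomm : Commute (a • 1 + W) (1 + a • W) := by
      have := Commute.refl W
      exact (((Commute.one_left _).smul_left a).add_left
        ((Commute.one_right W).add_right (this.smul_right a)))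
    have hK1 : Intertwines K (a • 1 + W) (star (a • 1 + W)) := by
      simpa using (Intertwines.one.real_smul a).add hW.2
    have hK2 : Intertwines K (1 + a • W) (star (1 + a • W)) := by
      simpa using Intertwines.one.add (hW.2.real_smul a)
    refine ⟨mul_inverse_mem_unitary (hd ha) hcomm ?_ ?_, ?_⟩
    · simp [mul_add, add_mul, h1, smul_smul]; abel
    · simp [mul_add, add_mul, h2, smul_smul]; abel
    · have : (a • 1 + W) * Ring.inverse (1 + a • W) = Ring.inverse (1 + a • W) * (a • 1 + W) := by
        obtain ⟨u, hu⟩ := hd ha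
        rw [← hu] at hcomm ⊢
        rw [Ring.inverse_unit]
        exact hcomm.units_inv_right
      change Intertwines K ((a • 1 + W) * Ring.inverse (1 + a • W))
        (star ((a • 1 + W) * Ring.inverse (1 + a • W)))
      nth_rw 1 [this]
      rw [star_mul, ← Ring.inverse_star]
      exact (hK2.inverse (hd ha) (hd ha).star).mul hK1

theorem joinedIn_oddUnitary {K : H →L⋆[ℂ] H} (hK : ∀ x y, inner ℂ (K x) (K y) = inner ℂ y x)
    (hK2 : ∀ x, K (K x) = -x) {U : H →L[ℂ] H} (hU : U ∈ oddUnitary K) :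
    JoinedIn (oddUnitary K) U 1 := by
  have h1 := Unitary.star_mul_self_of_mem hU.1
  have h2 := Unitary.mul_star_self_of_mem hU.1
  have hKs : Intertwines K (star U) U := by simpa using hU.2.star hK hK2
  let S : H →L[ℂ] H := (-Complex.I) • U + Complex.I • star U
  have hS : IsSelfAdjoint S := by simp [S, IsSelfAdjoint, add_comm]
  have hKS : Intertwines K S S := by
    simpa [S, add_comm] using (hU.2.smul (-Complex.I)).add (hKs.smul Complex.I)
  obtain ⟨G, hG, hGG, hKG, hSG, hcomm⟩ := exists_sign hK hK2 hS hKS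
  have hUs : Commute (star U) U := h1.trans h2.symm
  have hSU : Commute S U := ((Commute.refl U).smul_left _).add_left (hUs.smul_left _)
  have hUG : Commute U G := by
    refine hcomm U hSU ?_
    simpa [hS.star_eq] using hSU.star_star
  have hUG' : Commute (star U) G := by simpa [hG.star_eq] using hUG.star_star
  have hE (c s : ℂ) (hc : star c = c) (hs : star s = -s) (hcs : c * c - s * s = 1) :
      U * (c • 1 + s • G) ∈ oddUnitary K := by
    have e : star (c • 1 + s • G) = c • 1 + (-s) • G := by
      rw [star_add, star_smul, star_smul, star_one, hG.star_eq, hc, hs]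
    have e1 : star (c • 1 + s • G) * (c • 1 + s • G) = 1 := by
      rw [e]
      calc _ = (c * c - s * s) • (1 : H →L[ℂ] H) + (c * s - s * c) • G := by
            simp only [mul_add, add_mul, smul_mul_smul, hGG, mul_one, one_mul]
            module
        _ = 1 := by rw [hcs, mul_comm, sub_self, zero_smul, one_smul, add_zero]
    have e2 : (c • 1 + s • G) * star (c • 1 + s • G) = 1 := by
      rw [e]
      calc _ = (c * c - s * s) • (1 : H →L[ℂ] H) + (c * s - s * c) • G := by
            simp only [mul_add, add_mul, smul_mul_smul, hGG, mul_one, one_mul]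
            module
        _ = 1 := by rw [hcs, mul_comm, sub_self, zero_smul, one_smul, add_zero]
    refine ⟨mul_mem hU.1 (Unitary.mem_iff.2 ⟨e1, e2⟩), ?_⟩
    have := (hU.2.smul c).add ((hU.2.mul hKG).smul s)
    simpa [mul_add, add_mul, hG.star_eq, hUG'.eq] using this
  have hWmem : U * ((0 : ℂ) • 1 + (-Complex.I) • G) ∈ oddUnitary K :=
    hE _ _ (by simp) (by simp) (by simp)
  refine JoinedIn.trans (y := U * ((0 : ℂ) • 1 + (-Complex.I) • G)) ?_
    (joinedIn_oddUnitary_one hWmem ?_)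
  · refine JoinedIn.ofLine (f := fun t : ℝ ↦ U * ((Real.cos (t * (Real.pi / 2)) : ℂ) • 1 +
      (-Complex.I * (Real.sin (t * (Real.pi / 2)) : ℂ)) • G)) (by fun_prop) ?_ ?_ ?_
    · simp
    · simp
    · rintro _ ⟨t, -, rfl⟩
      refine hE _ _ (Complex.conj_ofReal _) ?_ ?_
      · rw [star_mul', star_neg]
        simp only [Complex.star_def, Complex.conj_ofReal, Complex.conj_I]
        ring
      · have := congr((($(Real.cos_sq_add_sin_sq (t * (Real.pi / 2))) : ℝ) : ℂ))
        push_cast at this ⊢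
        linear_combination this - Complex.sin (t * (Real.pi / 2)) ^ 2 * Complex.I_sq
  · convert hSG using 1
    simp [S, add_mul, hG.star_eq, hUG'.eq]

theorem joinedIn_oddInvertible {K : H →L⋆[ℂ] H} (hK : ∀ x y, inner ℂ (K x) (K y) = inner ℂ y x)
    (hK2 : ∀ x, K (K x) = -x) {T : H →L[ℂ] H} (hT : IsUnit T) (hKT : Intertwines K T (star T)) :
    JoinedIn {T : H →L[ℂ] H | IsUnit T ∧ Intertwines K T (star T)} T 1 := by
  have habs := CFC.abs_nonneg T
  have habsSA := IsSelfAdjoint.of_nonneg habs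
  have hsq : CFC.abs T * CFC.abs T = star T * T := CFC.abs_mul_abs T
  have hu : IsUnit (CFC.abs T) :=
    ((Commute.refl _).isUnit_mul_iff.1 (hsq ▸ hT.star.mul hT)).1
  set U := T * Ring.inverse (CFC.abs T) with hUdef
  have hTU : U * CFC.abs T = T := by
    rw [hUdef, mul_assoc, Ring.inverse_mul_cancel _ hu, mul_one]
  have hUunit : IsUnit U := hT.mul hu.ringInverse
  have hTU' : CFC.abs T * star U = star T := by
    rw [← habsSA.star_eq, ← star_mul, hTU]
  have hstar : star U * U = 1 := by
    apply hu.mul_left_cancel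
    apply hu.mul_right_cancel
    rw [mul_one, hsq, ← mul_assoc, hTU', mul_assoc, hTU]
  have hstar' : U * star U = 1 := by
    apply hUunit.mul_right_cancel
    rw [mul_assoc, hstar, one_mul, mul_one]
  have hnonneg : 0 ≤ U * CFC.abs T * star U := star_right_conjugate_nonneg habs U
  have hKabs : Intertwines K (CFC.abs T) (U * CFC.abs T * star U) := by
    refine .of_mul_self hK hK2 habs hnonneg ?_
    have : U * CFC.abs T * star U * (U * CFC.abs T * star U) = T * star T := by
      calc _ = U * CFC.abs T * (star U * U) * (CFC.abs T * star U) := by simp only [mul_assoc]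
        _ = _ := by rw [hstar, mul_one, hTU, hTU']
    rw [this, hsq]
    have hKs : Intertwines K (star T) T := by simpa using hKT.star hK hK2
    exact hKs.mul hKT
  have hKU : Intertwines K U (star U) := by
    have e : U = T * Ring.inverse (CFC.abs T) := rfl
    have hu' : IsUnit (U * CFC.abs T * star U) := (hUunit.mul hu).mul hUunit.star
    have := hKT.mul (hKabs.inverse hu hu')
    convert this using 1
    apply hu'.mul_right_cancel
    rw [mul_assoc (star T), Ring.inverse_mul_cancel _ hu', mul_one, mul_assoc U, ← mul_assoc,
      hstar, one_mul, hTU']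
  have hUodd : U ∈ oddUnitary K := ⟨Unitary.mem_iff.2 ⟨hstar, hstar'⟩, hKU⟩
  refine JoinedIn.trans (y := U) ?_ ((joinedIn_oddUnitary hK hK2 hUodd).mono ?_)
  · refine JoinedIn.ofLine (f := fun t : ℝ ↦ (1 - t) • T + t • U) (by fun_prop) (by simp)
      (by simp) ?_
    rintro _ ⟨t, ht, rfl⟩
    refine ⟨?_, ?_⟩
    · have : (1 - t) • T + t • U = U * ((1 - t) • CFC.abs T + t • 1) := by
        simp [mul_add, hTU]
      change IsUnit ((1 - t) • T + t • U)
      rw [this]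
      refine hUunit.mul ?_
      have h0 : 0 ≤ (1 - t) • CFC.abs T := smul_nonneg (sub_nonneg.2 ht.2) habs
      have h1 : 0 ≤ t • (1 : H →L[ℂ] H) := smul_nonneg ht.1 zero_le_one
      rcases ht.1.eq_or_lt with rfl | ht0
      · simpa using hu
      · have hs : IsUnit (t • (1 : H →L[ℂ] H)) := by
          simpa [Algebra.algebraMap_eq_smul_one] using
            (IsUnit.mk0 t ht0.ne').map (algebraMap ℝ (H →L[ℂ] H))
        exact CStarAlgebra.isUnit_of_le (t • 1) (le_add_of_nonneg_left h0)
          (IsUnit.isStrictlyPositive hs h1)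
    · simpa using (hKT.real_smul (1 - t)).add (hKU.real_smul t)
  · rintro V ⟨hV, hKV⟩
    exact ⟨(Unitary.toUnits ⟨V, hV⟩).isUnit, hKV⟩

/-- On a complex separable Hilbert space with complex conjugation `C` and real
unitary `I` with `I² = −1`, both the set of odd symmetric invertible operators and the set of
odd symmetric unitary operators are path-connected in the norm topology. -/
theorem oddSymmetric_invertibles_and_unitaries_pathConnected
    [TopologicalSpace.SeparableSpace H]
    (C : H ≃ₗᵢ⋆[ℂ] H) (hC : ∀ x, C (C x) = x)
    (I : H →L[ℂ] H) (hI : I ∈ unitary (H →L[ℂ] H))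
    (hIreal : ∀ x, C (I (C x)) = I x) (hI2 : I * I = -1) :
    IsPathConnected {T : H →L[ℂ] H | IsUnit T ∧ OddSymmetric C I T} ∧
    IsPathConnected {T : H →L[ℂ] H | T ∈ unitary (H →L[ℂ] H) ∧ OddSymmetric C I T} := by
  let K : H →L⋆[ℂ] H := (C.toContinuousLinearEquiv : H →L⋆[ℂ] H).comp I
  have hKapp (x) : K x = C (I x) := rfl
  have hII (x) : I (I x) = -x := congr($hI2 x)
  have hstarI (x) : adjoint I (I x) = x := congr($(Unitary.star_mul_self_of_mem hI) x)
  have hIstar (x) : I (adjoint I x) = x := congr($(Unitary.mul_star_self_of_mem hI) x)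
  have hCinner (x y) : inner ℂ (C x) (C y) = inner ℂ y x := by
    have e1 : C x - Complex.I • C y = C (x + Complex.I • y) := by
      rw [map_add, C.map_smulₛₗ]; simp [sub_eq_add_neg]
    have e2 : C x + Complex.I • C y = C (x - Complex.I • y) := by
      rw [map_sub, C.map_smulₛₗ]; simp
    have e3 : x + Complex.I • y = Complex.I • (y - Complex.I • x) := by
      rw [smul_sub, smul_smul, Complex.I_mul_I, neg_one_smul]; abel
    have e4 : x - Complex.I • y = -Complex.I • (y + Complex.I • x) := by
      rw [smul_add, smul_smul, neg_mul, Complex.I_mul_I, neg_neg, one_smul, neg_smul]; abel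
    rw [inner_eq_sum_norm_sq_div_four, inner_eq_sum_norm_sq_div_four, RCLike.I_to_complex, e1, e2,
      ← map_add, ← map_sub]
    simp only [C.norm_map]
    rw [e3, e4, norm_smul, norm_smul, add_comm x y, norm_sub_rev x y]
    simp
  have hK (x y) : inner ℂ (K x) (K y) = inner ℂ y x := by
    rw [hKapp, hKapp, hCinner, ← adjoint_inner_left, hstarI]
  have hK2 (x) : K (K x) = -x := by rw [hKapp, hKapp, hIreal, hII]
  have hCI (x) : C (I x) = I (C x) := by rw [← hIreal (C x), hC]
  have hodd (T : H →L[ℂ] H) : OddSymmetric C I T ↔ Intertwines K T (star T) := by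
    refine forall_congr' fun x ↦ ?_
    rw [hKapp, hKapp, star_eq_adjoint]
    constructor
    · intro h
      rw [← h, hIstar, hC]
    · intro h
      rw [h, hC, hstarI]
  simp only [hodd]
  exact ⟨⟨1, ⟨isUnit_one, by simpa using Intertwines.one⟩,
      fun {_} hT ↦ (joinedIn_oddInvertible hK hK2 hT.1 hT.2).symm⟩,
    ⟨1, ⟨one_mem _, by simpa using Intertwines.one⟩,
      fun {_} hT ↦ (joinedIn_oddUnitary hK hK2 hT).symm⟩⟩
end

section
/- Let K be a complex Hilbert space equipped with a complex conjugation C and a real unitary I (Ī = I) with I² = −1, and let T be an odd symmetric contraction on K, i.e. ‖T‖ ≤ 1 and I*TᵗI = T. Then the Halmos dilation U_T^H = [[T, (1 − TT*)^{1/2}], [(1 − T*T)^{1/2}, −T*]] is an odd symmetric unitary on K ⊕ K with respect to the conjugation C ⊕ C and the real unitary I ⊕ I; that is, (I ⊕ I)*(U_T^H)ᵗ(I ⊕ I) = U_T^H. -/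
open ContinuousLinearMap

/-- The 2×2 block operator `[[A, B], [C, D]]` on the Hilbert space direct sum `K ⊕ K`,
realized as `WithLp 2 (K × K)`. -/
noncomputable def blockOp {K : Type*} [NormedAddCommGroup K] [InnerProductSpace ℂ K]
    (A B C D : K →L[ℂ] K) : WithLp 2 (K × K) →L[ℂ] WithLp 2 (K × K) :=
  ((WithLp.prodContinuousLinearEquiv 2 ℂ K K).symm : K × K →L[ℂ] WithLp 2 (K × K)) ∘L
    (((A.coprod B).prod (C.coprod D)) ∘L
      ((WithLp.prodContinuousLinearEquiv 2 ℂ K K) : WithLp 2 (K × K) →L[ℂ] K × K))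

/-- The conjugation `C ⊕ C` acting diagonally on `K ⊕ K`. -/
noncomputable def conjSum {K : Type*} [NormedAddCommGroup K] [InnerProductSpace ℂ K]
    (C : K ≃ₗᵢ⋆[ℂ] K) : WithLp 2 (K × K) → WithLp 2 (K × K) :=
  fun x => (WithLp.equiv 2 (K × K)).symm
    (C ((WithLp.equiv 2 (K × K)) x).1, C ((WithLp.equiv 2 (K × K)) x).2)

lemma commute_of_commute_mul_self {A : Type*} [CStarAlgebra A] [PartialOrder A] [StarOrderedRing A]
    {a b : A} (ha : 0 ≤ a) (h : Commute (a * a) b) : Commute a b := by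
  rw [← CFC.sqrt_mul_self a ha, CFC.sqrt_eq_cfc]
  exact h.cfc_nnreal _

lemma withLp_prod_ext {K : Type*} {x y : WithLp 2 (K × K)} (h₁ : x.fst = y.fst)
    (h₂ : x.snd = y.snd) : x = y :=
  WithLp.ofLp_injective 2 (Prod.ext h₁ h₂)

section BlockOperators

variable {K : Type*} [NormedAddCommGroup K] [InnerProductSpace ℂ K]

lemma blockOp_apply_fst (A B C D : K →L[ℂ] K) (x : WithLp 2 (K × K)) :
    (blockOp A B C D x).fst = A x.fst + B x.snd := rfl

lemma blockOp_apply_snd (A B C D : K →L[ℂ] K) (x : WithLp 2 (K × K)) :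
    (blockOp A B C D x).snd = C x.fst + D x.snd := rfl

lemma conjSum_fst (C : K ≃ₗᵢ⋆[ℂ] K) (x : WithLp 2 (K × K)) : (conjSum C x).fst = C x.fst := rfl

lemma conjSum_snd (C : K ≃ₗᵢ⋆[ℂ] K) (x : WithLp 2 (K × K)) : (conjSum C x).snd = C x.snd := rfl

lemma blockOp_mul (A B C D A' B' C' D' : K →L[ℂ] K) :
    blockOp A B C D * blockOp A' B' C' D' =
      blockOp (A * A' + B * C') (A * B' + B * D') (C * A' + D * C') (C * B' + D * D') := by
  ext x
  refine withLp_prod_ext ?_ ?_ <;>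
  · simp only [mul_apply_eq_comp, blockOp_apply_fst, blockOp_apply_snd, map_add,
      add_apply]
    abel

lemma blockOp_one : blockOp (1 : K →L[ℂ] K) 0 0 1 = 1 := by
  ext x
  refine withLp_prod_ext ?_ ?_ <;> simp [blockOp_apply_fst, blockOp_apply_snd]

variable [CompleteSpace K]

lemma adjoint_blockOp (A B C D : K →L[ℂ] K) :
    adjoint (blockOp A B C D) = blockOp (adjoint A) (adjoint C) (adjoint B) (adjoint D) := by
  symm
  rw [ContinuousLinearMap.eq_adjoint_iff]
  intro x y
  simp only [WithLp.prod_inner_apply]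
  change inner ℂ (blockOp _ _ _ _ x).fst y.fst + inner ℂ (blockOp _ _ _ _ x).snd y.snd =
    inner ℂ x.fst (blockOp _ _ _ _ y).fst + inner ℂ x.snd (blockOp _ _ _ _ y).snd
  simp only [blockOp_apply_fst, blockOp_apply_snd, inner_add_left, inner_add_right,
    adjoint_inner_left]
  ring

lemma adjoint_sqrt (P : K →L[ℂ] K) : adjoint (CFC.sqrt P) = CFC.sqrt P :=
  (CFC.sqrt_nonneg P).isSelfAdjoint.adjoint_eq

lemma blockOp_diagonal_nonneg {P Q : K →L[ℂ] K} (hP : 0 ≤ P) (hQ : 0 ≤ Q) :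
    0 ≤ blockOp P 0 0 Q := by
  have h : blockOp P 0 0 Q =
      blockOp (CFC.sqrt P) 0 0 (CFC.sqrt Q) * blockOp (CFC.sqrt P) 0 0 (CFC.sqrt Q) := by
    simp [blockOp_mul, CFC.sqrt_mul_sqrt_self P hP, CFC.sqrt_mul_sqrt_self Q hQ]
  rw [h]
  refine IsSelfAdjoint.mul_self_nonneg ?_
  rw [IsSelfAdjoint, star_eq_adjoint, adjoint_blockOp, adjoint_sqrt, adjoint_sqrt, map_zero]

/-- An operator intertwining two positive operators intertwines their square roots. -/
lemma mul_sqrt_eq_sqrt_mul {T P Q : K →L[ℂ] K} (hP : 0 ≤ P) (hQ : 0 ≤ Q) (h : T * P = Q * T) :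
    T * CFC.sqrt P = CFC.sqrt Q * T := by
  have hcomm : Commute (blockOp P 0 0 Q) (blockOp 0 0 T 0) := by
    rw [Commute, SemiconjBy, blockOp_mul, blockOp_mul]
    simp [h]
  have hsqrt : Commute (blockOp (CFC.sqrt P) 0 0 (CFC.sqrt Q)) (blockOp 0 0 T 0) := by
    refine commute_of_commute_mul_self
      (blockOp_diagonal_nonneg (CFC.sqrt_nonneg P) (CFC.sqrt_nonneg Q)) ?_
    simpa [blockOp_mul, CFC.sqrt_mul_sqrt_self P hP, CFC.sqrt_mul_sqrt_self Q hQ] using hcomm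
  rw [Commute, SemiconjBy, blockOp_mul, blockOp_mul] at hsqrt
  ext x
  have hx := congrArg WithLp.snd (DFunLike.congr_fun hsqrt (WithLp.toLp 2 (x, 0)))
  simpa [blockOp_apply_snd] using hx.symm

end BlockOperators

section Contractions

variable {K : Type*} [NormedAddCommGroup K] [InnerProductSpace ℂ K] [CompleteSpace K]

lemma one_sub_adjoint_mul_self_nonneg {T : K →L[ℂ] K} (hT : ‖T‖ ≤ 1) :
    0 ≤ 1 - adjoint T * T := by
  rw [← star_eq_adjoint, sub_nonneg,
    ← CStarAlgebra.norm_le_one_iff_of_nonneg _ (star_mul_self_nonneg T),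
    CStarRing.norm_star_mul_self]
  exact mul_le_one₀ hT (norm_nonneg _) hT

lemma one_sub_self_mul_adjoint_nonneg {T : K →L[ℂ] K} (hT : ‖T‖ ≤ 1) :
    0 ≤ 1 - T * adjoint T := by
  have hT' : ‖adjoint T‖ ≤ 1 := by rwa [LinearIsometryEquiv.norm_map]
  simpa only [adjoint_adjoint] using one_sub_adjoint_mul_self_nonneg hT'

lemma mul_sqrt_defect {T : K →L[ℂ] K} (hT : ‖T‖ ≤ 1) :
    T * CFC.sqrt (1 - adjoint T * T) = CFC.sqrt (1 - T * adjoint T) * T :=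
  mul_sqrt_eq_sqrt_mul (one_sub_adjoint_mul_self_nonneg hT) (one_sub_self_mul_adjoint_nonneg hT)
    (by noncomm_ring)

/-- The Halmos dilation of a contraction is unitary. -/
lemma halmos_dilation_mem_unitary {T : K →L[ℂ] K} (hT : ‖T‖ ≤ 1) :
    blockOp T (CFC.sqrt (1 - T * adjoint T)) (CFC.sqrt (1 - adjoint T * T)) (-(adjoint T)) ∈
      unitary (WithLp 2 (K × K) →L[ℂ] WithLp 2 (K × K)) := by
  have hT' : ‖adjoint T‖ ≤ 1 := by rwa [LinearIsometryEquiv.norm_map]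
  have h₁ := mul_sqrt_defect hT
  have h₂ := mul_sqrt_defect hT'
  rw [adjoint_adjoint] at h₂
  have h₃ := CFC.sqrt_mul_sqrt_self _ (one_sub_adjoint_mul_self_nonneg hT)
  have h₄ := CFC.sqrt_mul_sqrt_self _ (one_sub_self_mul_adjoint_nonneg hT)
  rw [Unitary.mem_iff, star_eq_adjoint, adjoint_blockOp, blockOp_mul, blockOp_mul, ← blockOp_one]
  simp only [adjoint_sqrt, map_neg, adjoint_adjoint, mul_neg, neg_mul, neg_neg, h₁, h₂, h₃, h₄]
  constructor <;> congr 1 <;> abel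

end Contractions

section Conjugation

variable {K : Type*} [NormedAddCommGroup K] [InnerProductSpace ℂ K]

lemma inner_conjugation_conjugation (C : K ≃ₗᵢ⋆[ℂ] K) (x y : K) :
    inner ℂ (C x) (C y) = inner ℂ y x := by
  have hre : ∀ u v : K, (inner ℂ (C u) (C v)).re = (inner ℂ u v).re := fun u v => by
    have h₁ := re_inner_eq_norm_add_mul_self_sub_norm_mul_self_sub_norm_mul_self_div_two
      (𝕜 := ℂ) (C u) (C v)
    have h₂ := re_inner_eq_norm_add_mul_self_sub_norm_mul_self_sub_norm_mul_self_div_two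
      (𝕜 := ℂ) u v
    rw [← map_add, C.norm_map, C.norm_map, C.norm_map, ← h₂] at h₁
    exact h₁
  have him := hre x (Complex.I • y)
  rw [LinearIsometryEquiv.map_smulₛₗ, inner_smul_right, inner_smul_right] at him
  rw [← inner_conj_symm y x]
  apply Complex.ext
  · rw [Complex.conj_re, hre]
  · rw [Complex.conj_im]
    simpa using him

/-- The complex conjugate `C A C` of a bounded operator, for a conjugation `C`. -/
noncomputable def conjugateOp (C : K ≃ₗᵢ⋆[ℂ] K) (A : K →L[ℂ] K) : K →L[ℂ] K :=
  (C : K →L⋆[ℂ] K).comp (A.comp (C : K →L⋆[ℂ] K))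

lemma conjugateOp_apply (C : K ≃ₗᵢ⋆[ℂ] K) (A : K →L[ℂ] K) (x : K) :
    conjugateOp C A x = C (A (C x)) := rfl

lemma conjugateOp_mul {C : K ≃ₗᵢ⋆[ℂ] K} (hC : ∀ x, C (C x) = x) (A B : K →L[ℂ] K) :
    conjugateOp C (A * B) = conjugateOp C A * conjugateOp C B := by
  ext x
  simp [conjugateOp_apply, hC]

lemma conjugateOp_one {C : K ≃ₗᵢ⋆[ℂ] K} (hC : ∀ x, C (C x) = x) :
    conjugateOp C 1 = 1 := by
  ext x
  simp [conjugateOp_apply, hC]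

lemma conjugateOp_sub (C : K ≃ₗᵢ⋆[ℂ] K) (A B : K →L[ℂ] K) :
    conjugateOp C (A - B) = conjugateOp C A - conjugateOp C B := by
  ext x
  simp [conjugateOp_apply]

variable [CompleteSpace K]

lemma adjoint_conjugateOp {C : K ≃ₗᵢ⋆[ℂ] K} (hC : ∀ x, C (C x) = x) (A : K →L[ℂ] K) :
    adjoint (conjugateOp C A) = conjugateOp C (adjoint A) := by
  symm
  rw [ContinuousLinearMap.eq_adjoint_iff]
  intro x y
  have h₁ := inner_conjugation_conjugation C (adjoint A (C x)) (C y)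
  have h₂ := inner_conjugation_conjugation C (C x) (A (C y))
  rw [hC] at h₁ h₂
  rw [conjugateOp_apply, conjugateOp_apply, h₁, h₂, adjoint_inner_right]

lemma conjugateOp_nonneg {C : K ≃ₗᵢ⋆[ℂ] K} (hC : ∀ x, C (C x) = x) {A : K →L[ℂ] K}
    (hA : 0 ≤ A) : 0 ≤ conjugateOp C A := by
  rw [← CFC.sqrt_mul_sqrt_self A hA, conjugateOp_mul hC]
  refine IsSelfAdjoint.mul_self_nonneg ?_
  rw [IsSelfAdjoint, star_eq_adjoint, adjoint_conjugateOp hC, adjoint_sqrt]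

/-- If `T` is odd symmetric, then the transpose of the defect operator of `T`, conjugated by the
symmetry `I`, is the defect operator of `T*`. -/
lemma adjoint_mul_conjugateOp_sqrt_defect_mul {C : K ≃ₗᵢ⋆[ℂ] K} (hC : ∀ x, C (C x) = x)
    {I : K →L[ℂ] K} (hI : I ∈ unitary (K →L[ℂ] K)) {T : K →L[ℂ] K} (hT : ‖T‖ ≤ 1)
    (hTodd : adjoint I * conjugateOp C (adjoint T) * I = T) :
    adjoint I * conjugateOp C (CFC.sqrt (1 - adjoint T * T)) * I =
      CFC.sqrt (1 - T * adjoint T) := by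
  have hII : I * adjoint I = 1 := Unitary.mul_star_self_of_mem hI
  have hII' : adjoint I * I = 1 := Unitary.star_mul_self_of_mem hI
  have cancel : ∀ A B : K →L[ℂ] K,
      adjoint I * A * I * (adjoint I * B * I) = adjoint I * (A * B) * I := fun A B => by
    calc _ = adjoint I * A * (I * adjoint I) * B * I := by noncomm_ring
      _ = _ := by rw [hII]; noncomm_ring
  have hTodd' : adjoint I * conjugateOp C T * I = adjoint T := by
    have h := congrArg star hTodd
    simpa only [star_mul, star_eq_adjoint, adjoint_conjugateOp hC, adjoint_adjoint,
      mul_assoc] using h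
  symm
  refine CFC.sqrt_unique ?_ ?_
  · rw [cancel, ← conjugateOp_mul hC,
      CFC.sqrt_mul_sqrt_self _ (one_sub_adjoint_mul_self_nonneg hT), conjugateOp_sub,
      conjugateOp_one hC, conjugateOp_mul hC, mul_sub, sub_mul, mul_one, hII', ← cancel, hTodd,
      hTodd']
  · exact star_left_conjugate_nonneg (conjugateOp_nonneg hC (CFC.sqrt_nonneg _)) I

end Conjugation

/-- If `T` is an odd symmetric contraction on `K` (w.r.t. the conjugation `C`
and the real unitary `I` with `I² = −1`), then the Halmos dilation
`U_T^H = [[T, (1 − TT*)^{1/2}], [(1 − T*T)^{1/2}, −T*]]` is an odd symmetric unitary on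
`K ⊕ K` w.r.t. `C ⊕ C` and `I ⊕ I`, i.e. `(I ⊕ I)* (U_T^H)ᵗ (I ⊕ I) = U_T^H`. -/
theorem halmos_dilation_oddSymmetric
    {K : Type*} [NormedAddCommGroup K] [InnerProductSpace ℂ K] [CompleteSpace K]
    (C : K ≃ₗᵢ⋆[ℂ] K) (hC : ∀ x, C (C x) = x)
    (I : K →L[ℂ] K) (hI : I ∈ unitary (K →L[ℂ] K))
    (hIreal : ∀ x, C (I (C x)) = I x) (hI2 : I * I = -1)
    (T : K →L[ℂ] K) (hT : ‖T‖ ≤ 1)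
    (hTodd : ∀ x, adjoint I (C (adjoint T (C (I x)))) = T x) :
    blockOp T (CFC.sqrt (1 - T * adjoint T)) (CFC.sqrt (1 - adjoint T * T)) (-(adjoint T)) ∈
        unitary (WithLp 2 (K × K) →L[ℂ] WithLp 2 (K × K)) ∧
      ∀ x, adjoint (blockOp I 0 0 I)
          (conjSum C
            (adjoint (blockOp T (CFC.sqrt (1 - T * adjoint T))
                (CFC.sqrt (1 - adjoint T * T)) (-(adjoint T)))
              (conjSum C (blockOp I 0 0 I x)))) =
        blockOp T (CFC.sqrt (1 - T * adjoint T)) (CFC.sqrt (1 - adjoint T * T))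
          (-(adjoint T)) x := by
  have hT' : ‖adjoint T‖ ≤ 1 := by rwa [LinearIsometryEquiv.norm_map]
  have hodd : adjoint I * conjugateOp C (adjoint T) * I = T := by
    ext x
    exact hTodd x
  have hodd' : adjoint I * conjugateOp C T * I = adjoint T := by
    have h := congrArg star hodd
    simpa only [star_mul, star_eq_adjoint, adjoint_conjugateOp hC, adjoint_adjoint,
      mul_assoc] using h
  have h₁ := adjoint_mul_conjugateOp_sqrt_defect_mul hC hI hT hodd
  have h₂ := adjoint_mul_conjugateOp_sqrt_defect_mul hC hI hT'
    (by rwa [adjoint_adjoint])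
  rw [adjoint_adjoint] at h₂
  refine ⟨halmos_dilation_mem_unitary hT, fun x => ?_⟩
  have e₁ := DFunLike.congr_fun h₁
  have e₂ := DFunLike.congr_fun h₂
  have e₃ := DFunLike.congr_fun hodd'
  simp only [mul_apply_eq_comp, conjugateOp_apply] at e₁ e₂ e₃
  rw [adjoint_blockOp, adjoint_blockOp]
  refine withLp_prod_ext ?_ ?_ <;>
  simp [blockOp_apply_fst, blockOp_apply_snd, conjSum_fst, conjSum_snd, adjoint_sqrt, hTodd, e₁,
    e₂, e₃]
end
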